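/- arXiv:1103.5388 — 7 statements merged into one kernel-verified Lean document; each statement's English description precedes it below -/
import Mathlib

section
/- Let a and b be coprime integers. If a prime number q divides both a + b and φ(a, b), then q = 5. -/
/-- φ(a, b) = a⁴ - a³b + a²b² - ab³ + b⁴ -/
def phi (a b : ℤ) : ℤ := a ^ 4 - a ^ 3 * b + a ^ 2 * b ^ 2 - a * b ^ 3 + b ^ 4

theorem prime_dvd_add_and_phi_eq_five
    (a b : ℤ) (hab : IsCoprime a b)
    (q : ℕ) (hq : q.Prime) (h1 : (q : ℤ) ∣ a + b) (h2 : (q : ℤ) ∣ phi a b) :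
    q = 5 := by
  have hq' : Prime (q : ℤ) := Nat.prime_iff_prime_int.mp hq
  have h5 : (q : ℤ) ∣ 5 * b ^ 4 := by
    have key : 5 * b ^ 4 =
        phi a b - (a + b) * (a ^ 3 - 2 * a ^ 2 * b + 3 * a * b ^ 2 - 4 * b ^ 3) := by
      unfold phi
      ring
    exact key ▸ dvd_sub h2 (h1.mul_right _)
  rcases hq'.dvd_or_dvd h5 with h | h
  · exact (Nat.prime_dvd_prime_iff_eq hq Nat.prime_five).mp (by exact_mod_cast h)
  · have hb : (q : ℤ) ∣ b := hq'.dvd_of_dvd_pow h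
    have ha : (q : ℤ) ∣ a := (dvd_add_left hb).mp h1
    exact absurd (hab.isUnit_of_dvd' ha hb) hq'.not_isUnit
end

section
/- Let a and b be coprime integers. If 5 divides a + b, then 5 divides φ(a, b) but 25 does not divide φ(a, b); that is, the 5-adic valuation of φ(a, b) equals 1. -/
theorem five_dvd_phi_not_twentyfive
    (a b : ℤ) (hab : IsCoprime a b) (h5 : (5 : ℤ) ∣ a + b) :
    (5 : ℤ) ∣ phi a b ∧ ¬ (25 : ℤ) ∣ phi a b := by
  obtain ⟨k, hk⟩ := h5
  have expansion : phi a b =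
      25 * (25 * k ^ 4 - 25 * k ^ 3 * b + 10 * k ^ 2 * b ^ 2 - 2 * k * b ^ 3) + 5 * b ^ 4 := by
    rw [eq_sub_of_add_eq hk, phi]
    ring
  refine ⟨by rw [expansion]; omega, fun h25 => ?_⟩
  have prime_five : Prime (5 : ℤ) := by norm_num
  have hb : (5 : ℤ) ∣ b := prime_five.dvd_of_dvd_pow (n := 4) (by rw [expansion] at h25; omega)
  have ha : (5 : ℤ) ∣ a := by omega
  exact prime_five.not_isUnit (hab.isUnit_of_dvd' ha hb)
end

section
/- Let d ∈ {2, 3}, let p be an odd prime, and let a, b, c be integers with gcd(a, b) = 1 and a^5 + b^5 = d·c^p. Then d divides a + b, and there exists a positive integer c₀ dividing c, coprime to 5d, all of whose prime divisors are ≡ 1 (mod 5), such that φ(a, b) = c₀^p if 5 does not divide a + b, and φ(a, b) = 5·c₀^p if 5 divides a + b. -/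
theorem phi_eq_add_mul (a b : ℤ) :
    phi a b = (a + b) ^ 4 - 5 * (a * b) * (a + b) ^ 2 + 5 * (a * b) ^ 2 := by
  unfold phi; ring

theorem add_mul_phi (a b : ℤ) : (a + b) * phi a b = a ^ 5 + b ^ 5 := by
  unfold phi; ring

theorem phi_pos {a b : ℤ} (hab : IsCoprime a b) : 0 < phi a b := by
  have h : 0 < a ^ 2 + b ^ 2 := by
    rcases eq_or_ne a 0 with rfl | ha
    · have hb : b ≠ 0 := by
        rintro rfl
        exact not_isCoprime_zero_zero hab
      positivity
    · positivity
  have h4 : 4 * phi a b = (a ^ 2 + b ^ 2) ^ 2 + (a - b) ^ 4 + 2 * (a ^ 2 - b ^ 2) ^ 2 := by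
    unfold phi; ring
  have : 0 < 4 * phi a b := by rw [h4]; positivity
  linarith

theorem isCoprime_add_mul {a b : ℤ} (hab : IsCoprime a b) : IsCoprime (a + b) (a * b) := by
  refine IsCoprime.mul_right ?_ ?_
  · simpa [add_comm] using (hab.symm.add_mul_left_left 1)
  · simpa using (hab.add_mul_left_left 1)

/-- The prime-to-`5` part of `phi a b` is coprime to `5 * (a + b)`. -/
theorem exists_phi_eq_mul_isCoprime {a b : ℤ} (hab : IsCoprime a b) :
    ∃ e ψ : ℤ, phi a b = e * ψ ∧ IsCoprime ψ (5 * (a + b)) ∧ 0 < ψ ∧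
      (¬ (5 : ℤ) ∣ a + b → e = 1) ∧ ((5 : ℤ) ∣ a + b → e = 5) := by
  have hs := isCoprime_add_mul hab
  have hpos := phi_pos hab
  have hφ := phi_eq_add_mul a b
  by_cases h5 : (5 : ℤ) ∣ a + b
  · obtain ⟨k, hk⟩ := h5
    have h : phi a b = 5 * ((a * b) ^ 2 + 5 * (a + b) * (5 * k ^ 3 - a * b * k)) := by
      rw [hφ, hk]; ring
    refine ⟨5, _, h, ?_, by linarith, fun h => absurd ⟨k, hk⟩ h, fun _ => rfl⟩
    refine IsCoprime.add_mul_left_left ?_ _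
    exact (IsCoprime.mul_right (hs.of_isCoprime_of_dvd_left ⟨k, hk⟩).symm hs.symm).pow_left
  · refine ⟨1, phi a b, (one_mul _).symm, ?_, hpos, fun _ => rfl, fun h => absurd h h5⟩
    have h5s : IsCoprime (5 : ℤ) (a + b) := by
      exact (Prime.coprime_iff_not_dvd (by norm_num)).2 h5
    refine IsCoprime.mul_right ?_ ?_
    · rw [hφ, show (a + b) ^ 4 - 5 * (a * b) * (a + b) ^ 2 + 5 * (a * b) ^ 2 =
        (a + b) ^ 4 + 5 * ((a * b) ^ 2 - (a * b) * (a + b) ^ 2) by ring]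
      exact IsCoprime.add_mul_left_left h5s.symm.pow_left _
    · rw [hφ, show (a + b) ^ 4 - 5 * (a * b) * (a + b) ^ 2 + 5 * (a * b) ^ 2 =
        5 * (a * b) ^ 2 + (a + b) * ((a + b) ^ 3 - 5 * (a * b) * (a + b)) by ring]
      exact IsCoprime.add_mul_left_left (h5s.mul_left hs.symm.pow_left) _

/-- A prime dividing `a ^ 5 + b ^ 5` but not `a + b` is congruent to `1` modulo `5`. -/
theorem mod_five_eq_one_of_dvd {a b : ℤ} (hab : IsCoprime a b) {q : ℕ} (hq : q.Prime)
    (hdvd : (q : ℤ) ∣ a ^ 5 + b ^ 5) (hndvd : ¬ (q : ℤ) ∣ a + b) : q % 5 = 1 := by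
  have := Fact.mk hq
  have : Fact (Nat.Prime 5) := ⟨by norm_num⟩
  have hqZ : Prime (q : ℤ) := Nat.prime_iff_prime_int.mp hq
  have hb : (b : ZMod q) ≠ 0 := by
    intro h0
    have hqb : (q : ℤ) ∣ b := (ZMod.intCast_zmod_eq_zero_iff_dvd b q).1 h0
    have hqa : (q : ℤ) ∣ a :=
      hqZ.dvd_of_dvd_pow ((dvd_add_left (dvd_pow hqb (by norm_num : 5 ≠ 0))).1 hdvd)
    exact hqZ.not_isUnit (hab.isUnit_of_dvd' hqa hqb)
  have hsum : (a : ZMod q) ^ 5 + (b : ZMod q) ^ 5 = 0 := by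
    exact_mod_cast (ZMod.intCast_zmod_eq_zero_iff_dvd (a ^ 5 + b ^ 5) q).2 hdvd
  have hne : (a : ZMod q) + b ≠ 0 := fun h =>
    hndvd ((ZMod.intCast_zmod_eq_zero_iff_dvd (a + b) q).1 (by exact_mod_cast h))
  have hx5 : (-(a : ZMod q) / b) ^ 5 = 1 := by
    rw [div_pow, div_eq_one_iff_eq (pow_ne_zero _ hb)]
    linear_combination -hsum
  have hx1 : -(a : ZMod q) / b ≠ 1 := by
    rw [Ne, div_eq_one_iff_eq hb]
    intro h
    exact hne (by linear_combination -h)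
  have hx0 : -(a : ZMod q) / b ≠ 0 := by
    intro h
    rw [h] at hx5
    norm_num at hx5
  have h5 : 5 ∣ q - 1 := by
    rw [← orderOf_eq_prime hx5 hx1]
    exact orderOf_dvd_of_pow_eq_one (ZMod.pow_card_sub_one_eq_one hx0)
  have := hq.two_le
  omega

theorem dvd_add_of_dvd_pow_five_add {d a b : ℤ} (hd : d = 2 ∨ d = 3)
    (h : d ∣ a ^ 5 + b ^ 5) : d ∣ a + b := by
  rcases hd with rfl | rfl
  · have key : ∀ x y : ZMod 2, x ^ 5 + y ^ 5 = 0 → x + y = 0 := by decide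
    have := key a b (by exact_mod_cast (ZMod.intCast_zmod_eq_zero_iff_dvd _ 2).2 h)
    exact (ZMod.intCast_zmod_eq_zero_iff_dvd (a + b) 2).1 (by exact_mod_cast this)
  · have key : ∀ x y : ZMod 3, x ^ 5 + y ^ 5 = 0 → x + y = 0 := by decide
    have := key a b (by exact_mod_cast (ZMod.intCast_zmod_eq_zero_iff_dvd _ 3).2 h)
    exact (ZMod.intCast_zmod_eq_zero_iff_dvd (a + b) 3).1 (by exact_mod_cast this)

/-- A positive factor coprime to its cofactor in a perfect `p`-th power is a `p`-th power. -/
theorem exists_pos_eq_pow_of_mul_eq_pow {u ψ c : ℤ} {p : ℕ} (hp : p ≠ 0)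
    (hψ : 0 < ψ) (hu : IsCoprime ψ u) (h : ψ * u = c ^ p) : ∃ c₀ : ℤ, 0 < c₀ ∧ ψ = c₀ ^ p := by
  obtain ⟨x, hx⟩ := exists_associated_pow_of_mul_eq_pow' hu h
  have habs : ψ = |x| ^ p := by
    rw [← abs_pow, ← abs_of_pos hψ]
    rw [Int.abs_eq_natAbs, Int.abs_eq_natAbs, Int.associated_iff_natAbs.1 hx]
  refine ⟨|x|, abs_pos.2 ?_, habs⟩
  rintro rfl
  rw [abs_zero, zero_pow hp] at habs
  exact hψ.ne' habs

theorem reduction_to_phi_equation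
    (d : ℤ) (hd : d = 2 ∨ d = 3)
    (p : ℕ) (hp : p.Prime) (hodd : Odd p)
    (a b c : ℤ) (hab : IsCoprime a b)
    (heq : a ^ 5 + b ^ 5 = d * c ^ p) :
    d ∣ a + b ∧
    ∃ c₀ : ℤ, 0 < c₀ ∧ c₀ ∣ c ∧ IsCoprime c₀ (5 * d) ∧
      (∀ q : ℕ, q.Prime → (q : ℤ) ∣ c₀ → q % 5 = 1) ∧
      (¬ (5 : ℤ) ∣ a + b → phi a b = c₀ ^ p) ∧
      ((5 : ℤ) ∣ a + b → phi a b = 5 * c₀ ^ p) := by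
  have hds : d ∣ a + b := dvd_add_of_dvd_pow_five_add hd ⟨_, heq⟩
  refine ⟨hds, ?_⟩
  obtain ⟨e, ψ, hφ, hcop, hψ, he1, he5⟩ := exists_phi_eq_mul_isCoprime hab
  have hd0 : d ≠ 0 := by rcases hd with rfl | rfl <;> norm_num
  obtain ⟨t, ht⟩ := hds
  have hmul : ψ * (e * t) = c ^ p := by
    apply mul_left_cancel₀ hd0
    rw [← heq, ← add_mul_phi, hφ, ht]
    ring
  have he : e * t ∣ 5 * (a + b) := by
    refine mul_dvd_mul ?_ ⟨d, by rw [ht, mul_comm]⟩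
    by_cases h : (5 : ℤ) ∣ a + b
    · rw [he5 h]
    · rw [he1 h]; exact one_dvd _
  obtain ⟨c₀, hc₀, rfl⟩ := exists_pos_eq_pow_of_mul_eq_pow hp.ne_zero hψ
    (hcop.of_isCoprime_of_dvd_right he) hmul
  have hc₀cop : IsCoprime c₀ (5 * (a + b)) := (IsCoprime.pow_left_iff hp.pos).1 hcop
  refine ⟨c₀, hc₀, (Int.pow_dvd_pow_iff hp.ne_zero).1 ⟨_, hmul.symm⟩,
    hc₀cop.of_isCoprime_of_dvd_right (mul_dvd_mul_left 5 ⟨t, ht⟩), fun q hq hqc => ?_,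
    fun h => by rw [hφ, he1 h, one_mul], fun h => by rw [hφ, he5 h]⟩
  refine mod_five_eq_one_of_dvd hab hq ?_ fun h => ?_
  · rw [← add_mul_phi, hφ]
    exact ((hqc.trans (dvd_pow_self c₀ hp.ne_zero)).mul_left e).mul_left _
  · exact (Nat.prime_iff_prime_int.mp hq).not_isUnit
      (hc₀cop.isUnit_of_dvd' hqc (h.mul_left 5))
end

section
/- Let K = ℚ(√5) with ring of integers O_K, and set ω = (-1 + √5)/2 and ω̄ = (-1 - √5)/2 in O_K. Let a and b be coprime integers and set φ₁(a, b) = a² + ω·a·b + b² and φ₂(a, b) = a² + ω̄·a·b + b² in O_K. If a prime ideal P of O_K divides both the ideal generated by φ₁(a, b) and the ideal generated by φ₂(a, b), then P lies above 5 (i.e., 5 ∈ P). -/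
open NumberField

/-- If `a² + r a b + b²` and `a² + s a b + b²` lie in a prime ideal `P` and `a`, `b` are coprime,
then `r - s ∈ P`. -/
theorem Ideal.IsPrime.sub_mem_of_sq_add_mul_add_sq_mem {R : Type*} [CommRing R] {P : Ideal R}
    (hP : P.IsPrime) {a b r s : R} (hab : IsCoprime a b)
    (hr : a ^ 2 + r * a * b + b ^ 2 ∈ P) (hs : a ^ 2 + s * a * b + b ^ 2 ∈ P) :
    r - s ∈ P := by
  have not_both : a ∈ P → b ∈ P → False := by
    intro ha hb
    obtain ⟨u, v, huv⟩ := hab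
    refine hP.ne_top (P.eq_top_iff_one.mpr ?_)
    rw [← huv]
    exact P.add_mem (P.mul_mem_left u ha) (P.mul_mem_left v hb)
  have hprod : (r - s) * a * b ∈ P := by
    convert P.sub_mem hr hs using 1
    ring
  rcases hP.mem_or_mem hprod with h | hb
  · rcases hP.mem_or_mem h with h | ha
    · exact h
    · refine (not_both ha (hP.mem_of_pow_mem 2 ?_)).elim
      convert P.sub_mem hr (P.mul_mem_left (a + r * b) ha) using 1
      ring
  · refine (not_both (hP.mem_of_pow_mem 2 ?_) hb).elim
    convert P.sub_mem hr (P.mul_mem_left (r * a + b) hb) using 1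
    ring

theorem phi_factors_coprime_outside_five
    (K : Type*) [Field K] [NumberField K]
    (hrank : Module.finrank ℚ K = 2)
    (sq5 : K) (hsq5 : sq5 ^ 2 = 5)
    (ω ωbar : 𝓞 K)
    (hω : (ω : K) = (-1 + sq5) / 2) (hωbar : (ωbar : K) = (-1 - sq5) / 2)
    (a b : ℤ) (hab : IsCoprime a b)
    (P : Ideal (𝓞 K)) (hP : P.IsPrime)
    (h1 : ((a : 𝓞 K) ^ 2 + ω * a * b + (b : 𝓞 K) ^ 2) ∈ P)
    (h2 : ((a : 𝓞 K) ^ 2 + ωbar * a * b + (b : 𝓞 K) ^ 2) ∈ P) :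
    (5 : 𝓞 K) ∈ P := by
  have hdisc : (ω - ωbar) * (ω - ωbar) = 5 := by
    apply RingOfIntegers.coe_injective
    have hsub : (ω : K) - ωbar = sq5 := by
      rw [hω, hωbar]
      ring
    rw [map_mul, map_sub, hsub, ← sq, hsq5, map_ofNat]
  rw [← hdisc]
  exact P.mul_mem_left _ (hP.sub_mem_of_sq_add_mul_add_sq_mem hab.intCast h1 h2)
end

section
/- Let R be a commutative ring, let w ∈ R satisfy w² + w - 1 = 0, write w̄ = -1 - w, and let a, b ∈ R. Set φ₁ = a² + w·a·b + b² and φ = a⁴ - a³b + a²b² - ab³ + b⁴. Then the Weierstrass curve y² = x³ + 2(a + b)x² - w̄·φ₁·x (i.e., with coefficients a₁ = 0, a₂ = 2(a + b), a₃ = 0, a₄ = -w̄·φ₁, a₆ = 0) has discriminant Δ = 2⁶ · w̄ · φ · φ₁. -/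
theorem frey_curve_discriminant
    {R : Type*} [CommRing R] (w : R) (hw : w ^ 2 + w - 1 = 0) (a b : R) :
    ({ a₁ := 0, a₂ := 2 * (a + b), a₃ := 0,
       a₄ := -((-1 - w) * (a ^ 2 + w * a * b + b ^ 2)), a₆ := 0 } : WeierstrassCurve R).Δ =
      2 ^ 6 * (-1 - w) * (a ^ 4 - a ^ 3 * b + a ^ 2 * b ^ 2 - a * b ^ 3 + b ^ 4) *
        (a ^ 2 + w * a * b + b ^ 2) := by
  have hφ : (a ^ 2 + w * a * b + b ^ 2) * (a ^ 2 + (-1 - w) * a * b + b ^ 2) =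
      a ^ 4 - a ^ 3 * b + a ^ 2 * b ^ 2 - a * b ^ 3 + b ^ 4 := by
    linear_combination -(a ^ 2 * b ^ 2) * hw
  have hφ₂ : (-1 - w) * ((a + b) ^ 2 + (-1 - w) * (a ^ 2 + w * a * b + b ^ 2)) =
      a ^ 2 + (-1 - w) * a * b + b ^ 2 := by
    linear_combination (a ^ 2 + b ^ 2 - (-1 - w) * a * b) * hw
  rw [← hφ, ← hφ₂]
  simp only [WeierstrassCurve.Δ, WeierstrassCurve.b₂, WeierstrassCurve.b₄, WeierstrassCurve.b₆,
    WeierstrassCurve.b₈]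
  ring
end

section
/- Let F be a field of characteristic different from 2, let w ∈ F satisfy w² + w - 1 = 0, write w̄ = -1 - w, and let s ∈ F satisfy s² = -2. Let a, b ∈ F and set φ₁ = a² + w·a·b + b², φ₂ = a² + w̄·a·b + b². Suppose x, y ∈ F with x ≠ 0 satisfy y² = x³ + 2(a + b)x² - w·φ₂·x. Then the point (X, Y) with X = -y²/(2x²) and Y = (s/4)·(y/x²)·(w·φ₂ + x²) satisfies Y² = X³ + 2(a + b)X² - w̄·φ₁·X. -/
/-- The 2-isogeny from `y² = x³ + Ax² + Bx` with kernel generated by `(0, 0)`, twisted by `s = √-2`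
so that its target is `Y² = X³ + AX² + CX` with `4C = A² - 4B`. -/
theorem twisted_two_isogeny_equation {F : Type*} [Field F] (h2 : (2 : F) ≠ 0)
    {s A B C x y : F} (hs : s ^ 2 = -2) (hC : 4 * C = A ^ 2 - 4 * B) (hx : x ≠ 0)
    (hxy : y ^ 2 = x ^ 3 + A * x ^ 2 + B * x) :
    (s / 4 * (y / x ^ 2) * (x ^ 2 - B)) ^ 2 =
      (-(y ^ 2) / (2 * x ^ 2)) ^ 3 + A * (-(y ^ 2) / (2 * x ^ 2)) ^ 2 +
        C * (-(y ^ 2) / (2 * x ^ 2)) := by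
  have h4 : (4 : F) ≠ 0 := by
    rw [show (4 : F) = 2 * 2 by norm_num]
    exact mul_ne_zero h2 h2
  obtain rfl : C = (A ^ 2 - 4 * B) / 4 := by rw [← hC, mul_div_cancel_left₀ _ h4]
  have hX : y ^ 2 / x ^ 2 = x + A + B / x := by
    rw [hxy]
    field_simp
  have hX' : -(y ^ 2) / (2 * x ^ 2) = -(x + A + B / x) / 2 := by
    rw [← hX]
    field_simp
  have hY : (s / 4 * (y / x ^ 2) * (x ^ 2 - B)) ^ 2 =
      s ^ 2 / 4 ^ 2 * (y ^ 2 / x ^ 2) * ((x ^ 2 - B) / x) ^ 2 := by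
    field_simp
  rw [hY, hX', hX, hs, show (4 : F) = 2 * 2 by norm_num]
  field_simp
  ring

theorem two_isogeny_formula
    {F : Type*} [Field F] (h2 : (2 : F) ≠ 0)
    (w : F) (hw : w ^ 2 + w - 1 = 0)
    (s : F) (hs : s ^ 2 = -2)
    (a b : F) (x y : F) (hx : x ≠ 0)
    (hxy : y ^ 2 = x ^ 3 + 2 * (a + b) * x ^ 2 -
      w * (a ^ 2 + (-1 - w) * a * b + b ^ 2) * x) :
    (s / 4 * (y / x ^ 2) * (w * (a ^ 2 + (-1 - w) * a * b + b ^ 2) + x ^ 2)) ^ 2 =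
      (-(y ^ 2) / (2 * x ^ 2)) ^ 3 + 2 * (a + b) * (-(y ^ 2) / (2 * x ^ 2)) ^ 2 -
        (-1 - w) * (a ^ 2 + w * a * b + b ^ 2) * (-(y ^ 2) / (2 * x ^ 2)) := by
  have h := twisted_two_isogeny_equation h2 hs (A := 2 * (a + b))
    (B := -(w * (a ^ 2 + (-1 - w) * a * b + b ^ 2)))
    (C := -((-1 - w) * (a ^ 2 + w * a * b + b ^ 2)))
    (by linear_combination 8 * a * b * hw) hx (by rw [hxy]; ring)
  rw [sub_neg_eq_add, add_comm (x ^ 2), neg_mul, ← sub_eq_add_neg] at h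
  exact h
end

section
/- Let K = ℚ(√5) with ring of integers O_K and ω = (-1 + √5)/2 ∈ O_K. Let a and b be coprime integers with 3 dividing a + b. Then a² + ω·a·b + b² ≡ 2 - ω (mod 3·O_K); that is, (a² + ω·a·b + b²) - (2 - ω) ∈ 3·O_K. -/
open NumberField

/-- If `a` and `b` are coprime integers with `3 ∣ a + b`, then `a ^ 2 ≡ 1` modulo `3`. -/
theorem three_dvd_sq_sub_one_of_isCoprime {a b : ℤ} (hab : IsCoprime a b)
    (h3 : (3 : ℤ) ∣ a + b) : (3 : ℤ) ∣ a ^ 2 - 1 := by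
  have ha : ¬ (3 : ℤ) ∣ a := fun ha => by
    have := hab.isUnit_of_dvd' ha ((dvd_add_right ha).1 h3)
    rw [Int.isUnit_iff] at this
    omega
  have hfactor : a ^ 2 - 1 = (a - 1) * (a + 1) := by ring
  rw [hfactor]
  rcases (by omega : (3 : ℤ) ∣ a - 1 ∨ (3 : ℤ) ∣ a + 1) with h | h
  · exact h.mul_right _
  · exact h.mul_left _

/-- The congruence `a ^ 2 + w * a * b + b ^ 2 ≡ 2 - w` modulo `3` holds in every commutative ring
when `a` and `b` are coprime integers with `3 ∣ a + b`. -/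
theorem three_dvd_sq_add_mul_add_sq_sub {R : Type*} [CommRing R] (w : R) {a b : ℤ}
    (hab : IsCoprime a b) (h3 : (3 : ℤ) ∣ a + b) :
    (3 : R) ∣ (a : R) ^ 2 + w * a * b + (b : R) ^ 2 - (2 - w) := by
  obtain ⟨m, hm⟩ := three_dvd_sq_sub_one_of_isCoprime hab h3
  obtain ⟨k, hk⟩ := h3
  have hm' : (a : R) ^ 2 - 1 = 3 * m := by exact_mod_cast congrArg (Int.cast : ℤ → R) hm
  have hk' : (a : R) + b = 3 * k := by exact_mod_cast congrArg (Int.cast : ℤ → R) hk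
  refine ⟨2 * m - w * m + k * a * w + 3 * k ^ 2 - 2 * k * a, ?_⟩
  rw [eq_sub_of_add_eq' hk']
  linear_combination (2 - w) * hm'

theorem frey_curve_coefficient_mod_three
    (K : Type*) [Field K] [NumberField K]
    (hrank : Module.finrank ℚ K = 2)
    (sq5 : K) (hsq5 : sq5 ^ 2 = 5)
    (ω : 𝓞 K) (hω : (ω : K) = (-1 + sq5) / 2)
    (a b : ℤ) (hab : IsCoprime a b) (h3 : (3 : ℤ) ∣ a + b) :
    (3 : 𝓞 K) ∣ ((a : 𝓞 K) ^ 2 + ω * a * b + (b : 𝓞 K) ^ 2 - (2 - ω)) :=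
  three_dvd_sq_add_mul_add_sq_sub ω hab h3
end
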